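/- Let A and B be strictly upper triangular n×n matrices over 𝔽₂ (hence Bott matrices). If there exists an 𝔽₂-algebra isomorphism φ : R(A) → R(B) that maps the 𝔽₂-span of the images of x_1,…,x_n onto the 𝔽₂-span of the images of y_1,…,y_n (i.e. a graded ring isomorphism), then A and B are Bott equivalent. -/

import Mathlib

open MvPolynomial Matrix

/-- (Op1) conjugation by a permutation matrix. -/
def PhiP {n : ℕ} (σ : Equiv.Perm (Fin n)) (A : Matrix (Fin n) (Fin n) (ZMod 2)) :
    Matrix (Fin n) (Fin n) (ZMod 2) :=
  σ.permMatrix (ZMod 2) * A * (σ⁻¹).permMatrix (ZMod 2)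

/-- (Op2) `Φ_k(A)_j = A_j + A^k_j A_k`. -/
def Phi2 {n : ℕ} (k : Fin n) (A : Matrix (Fin n) (Fin n) (ZMod 2)) :
    Matrix (Fin n) (Fin n) (ZMod 2) :=
  fun i j => A i j + A k j * A i k

/-- (Op3) `Φ^{ℓ,m}(A)`: add the `ℓ`-th row to the `m`-th row. -/
def Phi3 {n : ℕ} (l m : Fin n) (A : Matrix (Fin n) (Fin n) (ZMod 2)) :
    Matrix (Fin n) (Fin n) (ZMod 2) :=
  fun i j => if i = m then A l j + A m j else A i j

/-- One application of one of the operations (Op1), (Op2), (Op3). -/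
inductive BottStep {n : ℕ} :
    Matrix (Fin n) (Fin n) (ZMod 2) → Matrix (Fin n) (Fin n) (ZMod 2) → Prop
  | op1 (σ : Equiv.Perm (Fin n)) (A) : BottStep A (PhiP σ A)
  | op2 (k : Fin n) (A) : BottStep A (Phi2 k A)
  | op3 (l m : Fin n) (A) (h : l ≠ m) (hc : ∀ i, A i l = A i m) :
      BottStep A (Phi3 l m A)

/-- Bott equivalence: a finite sequence of the operations (Op1)--(Op3). -/
def BottEquivM {n : ℕ} (A B : Matrix (Fin n) (Fin n) (ZMod 2)) : Prop :=
  Relation.ReflTransGen BottStep A B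

/-- The polynomial `α_j = ∑_i A^i_j x_i`. -/
noncomputable def alphaP {n : ℕ} (A : Matrix (Fin n) (Fin n) (ZMod 2)) (j : Fin n) :
    MvPolynomial (Fin n) (ZMod 2) :=
  ∑ i : Fin n, C (A i j) * X i

/-- The ideal `(x_j² − x_j α_j : j = 1,…,n)`. -/
noncomputable def relIdeal {n : ℕ} (A : Matrix (Fin n) (Fin n) (ZMod 2)) :
    Ideal (MvPolynomial (Fin n) (ZMod 2)) :=
  Ideal.span {p | ∃ j : Fin n, p = X j ^ 2 - X j * alphaP A j}

/-- `R(A) = 𝔽₂[x_1,…,x_n]/(x_j² − x_j α_j)`, the mod 2 cohomology ring of the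
real Bott manifold `M(A)`. -/
def CohomRing {n : ℕ} (A : Matrix (Fin n) (Fin n) (ZMod 2)) : Type :=
  MvPolynomial (Fin n) (ZMod 2) ⧸ relIdeal A

noncomputable instance {n : ℕ} (A : Matrix (Fin n) (Fin n) (ZMod 2)) :
    CommRing (CohomRing A) :=
  Ideal.Quotient.commRing (relIdeal A)

noncomputable instance {n : ℕ} (A : Matrix (Fin n) (Fin n) (ZMod 2)) :
    Algebra (ZMod 2) (CohomRing A) :=
  Ideal.Quotient.algebra (ZMod 2)

/-- The image `x_j` of `X j` in `R(A)`. -/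
noncomputable def xcl {n : ℕ} (A : Matrix (Fin n) (Fin n) (ZMod 2)) (j : Fin n) :
    CohomRing A :=
  Ideal.Quotient.mk (relIdeal A) (X j)

/-- `H¹`: the `𝔽₂`-span of the images of `x_1,…,x_n` in `R(A)`. -/
noncomputable def H1 {n : ℕ} (A : Matrix (Fin n) (Fin n) (ZMod 2)) :
    Submodule (ZMod 2) (CohomRing A) :=
  Submodule.span (ZMod 2) (Set.range (xcl A))

namespace BottAux

variable {n : ℕ}

theorem z2 (a : ZMod 2) : a = 0 ∨ a = 1 := by revert a; decide

theorem z2_ne {a : ZMod 2} (h : a ≠ 0) : a = 1 := (z2 a).resolve_left h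

/-- `1 + e_k wᵀ`. -/
def Tm (k : Fin n) (w : Fin n → ZMod 2) : Matrix (Fin n) (Fin n) (ZMod 2) :=
  1 + vecMulVec (Pi.single k 1) w

theorem Tm_mul_apply (k : Fin n) (w : Fin n → ZMod 2) (A : Matrix (Fin n) (Fin n) (ZMod 2))
    (i j : Fin n) : (Tm k w * A) i j = A i j + if i = k then ∑ l, w l * A l j else 0 := by
  unfold Tm
  rw [add_mul, one_mul, Matrix.add_apply]
  congr 1
  rw [Matrix.mul_apply]
  split_ifs with h
  · subst h; simp [vecMulVec_apply]
  · simp [vecMulVec_apply, h]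

theorem mul_Tm_apply (k : Fin n) (w : Fin n → ZMod 2) (P : Matrix (Fin n) (Fin n) (ZMod 2))
    (i j : Fin n) : (P * Tm k w) i j = P i j + P i k * w j := by
  unfold Tm
  rw [mul_add, mul_one, Matrix.add_apply]
  congr 1
  rw [Matrix.mul_apply]
  simp [vecMulVec_apply, Pi.single_apply]

theorem Tm_mul_Tm (k : Fin n) (w : Fin n → ZMod 2) (hw : w k = 0) :
    Tm k w * Tm k w = 1 := by
  ext i j
  rw [mul_Tm_apply]
  have h2 : ∀ a : ZMod 2, a + a = 0 := by decide
  simp only [Tm, Matrix.add_apply, vecMulVec_apply, Pi.single_apply, Matrix.one_apply, hw]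
  by_cases h : i = k <;> simp [h, add_assoc, h2]

theorem col_mul {A : Matrix (Fin n) (Fin n) (ZMod 2)} {i j : Fin n}
    (h : ∀ x, A x i = A x j) (M : Matrix (Fin n) (Fin n) (ZMod 2)) :
    ∀ x, (M * A) x i = (M * A) x j := by
  intro x
  simp [Matrix.mul_apply, h]

theorem equiv_rows (A : Matrix (Fin n) (Fin n) (ZMod 2)) (k : Fin n) (s : Finset (Fin n)) :
    k ∉ s → (∀ l ∈ s, ∀ i, A i l = A i k) →
    BottEquivM A (fun i j => A i j + if i = k then ∑ l ∈ s, A l j else 0) := by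
  induction s using Finset.induction_on with
  | empty =>
    intro _ _
    simp only [Finset.sum_empty, ite_self, add_zero]
    exact Relation.ReflTransGen.refl
  | insert l s hl ih =>
    intro hk hc
    rw [Finset.mem_insert, not_or] at hk
    have h1 := ih hk.2 (fun l' hl' => hc l' (Finset.mem_insert_of_mem hl'))
    refine Relation.ReflTransGen.tail h1 ?_
    have h2 := BottStep.op3 l k
      (fun i j => A i j + if i = k then ∑ l ∈ s, A l j else 0) (Ne.symm hk.1) (by
        intro i
        have := hc l (Finset.mem_insert_self _ _)
        simp [this])
    refine Eq.mp (congrArg _ ?_) h2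
    funext i j
    symm
    by_cases h : i = k
    · subst h
      have : l ≠ i := Ne.symm hk.1
      simp [Phi3, this, Finset.sum_insert hl]
      ring
    · simp [Phi3, h]

theorem equiv_Tm (A : Matrix (Fin n) (Fin n) (ZMod 2)) (k : Fin n) (w : Fin n → ZMod 2)
    (hw : w k = 0) (hc : ∀ l, w l ≠ 0 → ∀ i, A i l = A i k) :
    BottEquivM A (Tm k w * A) := by
  have := equiv_rows A k (Finset.univ.filter (fun l => w l ≠ 0)) (by simp [hw])
    (by intro l hl; exact hc l (by simpa using hl))
  refine Eq.mp (congrArg _ ?_) this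
  funext i j
  symm
  rw [Tm_mul_apply]
  congr 2
  rw [Finset.sum_filter]
  refine Finset.sum_congr rfl fun l _ => ?_
  rcases z2 (w l) with h | h <;> simp [h]

/-- hypothesis bundle for the elimination -/
structure Hyp (A P : Matrix (Fin n) (Fin n) (ZMod 2)) (S : Finset (Fin n)) : Prop where
  inv : ∃ R, P * R = 1
  cls : ∀ i j, P i j ≠ 0 → ∀ x, A x i = A x j
  row : ∀ i, i ∉ S → ∀ j, P i j = (1 : Matrix (Fin n) (Fin n) (ZMod 2)) i j

theorem Hyp.step {A P : Matrix (Fin n) (Fin n) (ZMod 2)} {S : Finset (Fin n)}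
    (h : Hyp A P S) (k : Fin n) (hk : k ∈ S) (w : Fin n → ZMod 2)
    (hw : w k = 0) (hc : ∀ l, w l ≠ 0 → ∀ i, A i l = A i k) :
    Hyp (Tm k w * A) (P * Tm k w) S := by
  obtain ⟨R, hR⟩ := h.inv
  refine ⟨⟨Tm k w * R, ?_⟩, ?_, ?_⟩
  · rw [mul_assoc, ← mul_assoc (Tm k w), Tm_mul_Tm k w hw, one_mul, hR]
  · intro i j hij
    apply col_mul
    rw [mul_Tm_apply] at hij
    by_cases h1 : P i j = 0
    · rw [h1, zero_add] at hij
      intro x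
      rw [h.cls i k (left_ne_zero_of_mul hij), hc j (right_ne_zero_of_mul hij)]
    · exact h.cls i j h1
  · intro i hi j
    have : i ≠ k := by rintro rfl; exact hi hk
    rw [mul_Tm_apply, h.row i hi, h.row i hi, Matrix.one_apply_ne this]
    simp

theorem mul_Tm_Tm_mul (A P : Matrix (Fin n) (Fin n) (ZMod 2)) (k : Fin n) (w : Fin n → ZMod 2)
    (hw : w k = 0) : (P * Tm k w) * (Tm k w * A) = P * A := by
  rw [mul_assoc, ← mul_assoc (Tm k w), Tm_mul_Tm k w hw, one_mul]

theorem equiv_block (S : Finset (Fin n)) : ∀ (A P : Matrix (Fin n) (Fin n) (ZMod 2)),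
    Hyp A P S → BottEquivM A (P * A) := by
  induction S using Finset.induction_on with
  | empty =>
    intro A P h
    have : P = 1 := by ext i j; exact h.row i (by simp) j
    rw [this, one_mul]; exact Relation.ReflTransGen.refl
  | insert k S hkS ih =>
    -- the case with nonzero pivot
    have key : ∀ (A P : Matrix (Fin n) (Fin n) (ZMod 2)), Hyp A P (insert k S) → P k k = 1 →
        BottEquivM A (P * A) := by
      intro A P h hp
      let w : Fin n → ZMod 2 := fun l => if l = k then 0 else P k l
      have hw : w k = 0 := by simp [w]
      have hc : ∀ l, w l ≠ 0 → ∀ i, A i l = A i k := by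
        intro l hl i
        have : P k l ≠ 0 := by
          intro h0; apply hl; simp [w, h0]
        exact (h.cls k l this i).symm
      have h1 := h.step k (Finset.mem_insert_self _ _) w hw hc
      have h2 : Hyp (Tm k w * A) (P * Tm k w) S := by
        refine ⟨h1.inv, h1.cls, ?_⟩
        intro i hi j
        by_cases hik : i = k
        · subst hik
          rw [mul_Tm_apply, hp, one_mul]
          have h2 : ∀ a : ZMod 2, a + a = 0 := by decide
          by_cases hj : j = i
          · subst hj; simp [w, hp]
          · simp [w, hj, h2, Matrix.one_apply_ne (Ne.symm hj)]
        · exact h1.row i (by simp [hik, hi]) j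
      have h3 := ih _ _ h2
      rw [mul_Tm_Tm_mul _ _ _ _ hw] at h3
      exact (equiv_Tm A k w hw hc).trans h3
    intro A P h
    by_cases hp : P k k = 0
    · have hex : ∃ i ∈ insert k S, P k i ≠ 0 := by
        by_contra hcon
        push Not at hcon
        obtain ⟨R, hR⟩ := h.inv
        have e1 : (P * R) k k = 0 := by
          rw [Matrix.mul_apply]
          apply Finset.sum_eq_zero
          intro j _
          by_cases hj : j ∈ insert k S
          · rw [hcon j hj, zero_mul]
          · have : (P * R) j k = R j k := by
              rw [Matrix.mul_apply]
              simp [h.row j hj, Matrix.one_apply]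
            have hjk : j ≠ k := by rintro rfl; simp at hj
            rw [← this, hR, Matrix.one_apply_ne hjk, mul_zero]
        rw [hR, Matrix.one_apply_eq] at e1
        exact one_ne_zero e1
      obtain ⟨i, hiS, hi⟩ := hex
      have hik : i ≠ k := by rintro rfl; exact hi hp
      have hw : (Pi.single k 1 : Fin n → ZMod 2) i = 0 := by simp [hik]
      have hc : ∀ l, (Pi.single k 1 : Fin n → ZMod 2) l ≠ 0 → ∀ x, A x l = A x i := by
        intro l hl
        have : l = k := by
          by_contra hlk; apply hl; simp [hlk]
        subst this
        exact h.cls _ _ hi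
      have h1 := h.step i hiS _ hw hc
      have h3 := key _ _ h1 (by rw [mul_Tm_apply, hp, z2_ne hi]; simp)
      rw [mul_Tm_Tm_mul _ _ _ _ hw] at h3
      exact (equiv_Tm A i _ hw hc).trans h3
    · exact key A P h (z2_ne hp)

theorem Phi2_eq (k : Fin n) (A : Matrix (Fin n) (Fin n) (ZMod 2)) :
    Phi2 k A = (1 + A * Matrix.single k k 1) * A := by
  ext i j
  rw [add_mul, one_mul, Matrix.add_apply, Matrix.mul_assoc, Matrix.mul_apply]
  simp only [Phi2]
  congr 1
  rw [Finset.sum_eq_single k]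
  · simp [mul_comm]
  · intro b _ hb; simp [hb]
  · simp

theorem equiv_main (S : Finset (Fin n)) : ∀ (A P D : Matrix (Fin n) (Fin n) (ZMod 2)),
    (∀ i j : Fin n, j ≤ i → A i j = 0) → (∃ R, P * R = 1) →
    P = D + P * A * Matrix.diagonal (fun k => if k ∈ S then 1 else 0) →
    (∀ i j, D i j ≠ 0 → ∀ x, A x i = A x j) → BottEquivM A (P * A) := by
  induction S using Finset.induction_on with
  | empty =>
    intro A P D hA hR hP hD
    have hPD : P = D := by simpa using hP
    subst hPD
    exact equiv_block Finset.univ A P ⟨hR, hD, by simp⟩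
  | insert k S hkS ih =>
    intro A P D hA ⟨R, hR⟩ hP hD
    set Q : Matrix (Fin n) (Fin n) (ZMod 2) := 1 + A * Matrix.single k k 1 with hQ
    have hchar : ∀ M : Matrix (Fin n) (Fin n) (ZMod 2), M + M = 0 := by
      intro M; ext i j; exact (by decide : ∀ a : ZMod 2, a + a = 0) _
    have hkk : Matrix.single k k (1 : ZMod 2) * A * Matrix.single k k 1 = 0 := by
      rw [Matrix.single_mul_mul_single]
      simp [hA k k le_rfl]
    have hQQ : Q * Q = 1 := by
      have : Q * Q = 1 + (A * Matrix.single k k 1 + A * Matrix.single k k 1) +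
          A * (Matrix.single k k 1 * A * Matrix.single k k 1) := by
        rw [hQ]; noncomm_ring
      rw [this, hkk, hchar]; simp
    have hQA : (P * Q) * (Q * A) = P * A := by
      rw [mul_assoc, ← mul_assoc Q, hQQ, one_mul]
    have h1 : BottEquivM A (Q * A) := by
      rw [hQ, ← Phi2_eq]
      exact Relation.ReflTransGen.single (BottStep.op2 k A)
    have h2 := ih (Q * A) (P * Q) D ?_ ⟨Q * R, ?_⟩ ?_ ?_
    · rw [hQA] at h2; exact h1.trans h2
    · intro i j hij
      rw [hQ, ← Phi2_eq]
      simp only [Phi2]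
      rw [hA i j hij, zero_add]
      by_cases hjk : j ≤ k
      · rw [hA k j hjk, zero_mul]
      · rw [hA i k (by omega), mul_zero]
    · rw [mul_assoc, ← mul_assoc Q, hQQ, one_mul, hR]
    · rw [hQA]
      have hdiag : (Matrix.diagonal (fun x => if x ∈ insert k S then (1 : ZMod 2) else 0)) =
          Matrix.diagonal (fun x => if x ∈ S then (1 : ZMod 2) else 0) +
            Matrix.single k k 1 := by
        rw [← Matrix.diagonal_single, Matrix.diagonal_add]
        congr 1
        ext x
        by_cases hx : x = k
        · subst hx; simp [hkS]
        · simp [hx]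
      have e : P * Q = P + P * A * Matrix.single k k 1 := by rw [hQ]; noncomm_ring
      rw [e]
      have e2 : P = D + (P * A * Matrix.diagonal (fun x => if x ∈ S then (1 : ZMod 2) else 0) +
          P * A * Matrix.single k k 1) := by
        rw [← mul_add, ← hdiag]; exact hP
      calc P + P * A * Matrix.single k k 1
          = (D + (P * A * Matrix.diagonal (fun x => if x ∈ S then (1 : ZMod 2) else 0) +
          P * A * Matrix.single k k 1)) + P * A * Matrix.single k k 1 := by rw [← e2]
        _ = _ := by rw [add_assoc, add_assoc, hchar, add_zero]
    · intro i j hij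
      exact col_mul (hD i j hij) Q

theorem PhiP_apply (σ : Equiv.Perm (Fin n)) (A : Matrix (Fin n) (Fin n) (ZMod 2)) (i j : Fin n) :
    PhiP σ A i j = A (σ i) (σ j) := by
  unfold PhiP Equiv.Perm.permMatrix
  rw [PEquiv.toMatrix_toPEquiv_mul, PEquiv.mul_toMatrix_toPEquiv]
  rfl

/-- the linear form with coefficient vector `u` -/
noncomputable def lin (u : Fin n → ZMod 2) : MvPolynomial (Fin n) (ZMod 2) :=
  ∑ i, C (u i) * X i

theorem lin_hom (u : Fin n → ZMod 2) : (lin u).IsHomogeneous 1 := by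
  apply MvPolynomial.IsHomogeneous.sum
  intro i _
  simpa using (isHomogeneous_C (Fin n) (u i)).mul (isHomogeneous_X (ZMod 2) i)

theorem eval_lin (u w : Fin n → ZMod 2) : eval w (lin u) = ∑ i, u i * w i := by
  simp [lin]

/-- the relation polynomial -/
noncomputable def rel (A : Matrix (Fin n) (Fin n) (ZMod 2)) (j : Fin n) :
    MvPolynomial (Fin n) (ZMod 2) := X j ^ 2 - X j * lin (fun i => A i j)

theorem rel_hom (A : Matrix (Fin n) (Fin n) (ZMod 2)) (j : Fin n) :
    (rel A j).IsHomogeneous 2 := by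
  apply MvPolynomial.IsHomogeneous.sub
  · simpa using (isHomogeneous_X (ZMod 2) j).pow 2
  · simpa using (isHomogeneous_X (ZMod 2) j).mul (lin_hom (fun i => A i j))

theorem mem_rel {A : Matrix (Fin n) (Fin n) (ZMod 2)} {p : MvPolynomial (Fin n) (ZMod 2)}
    (h : p ∈ relIdeal A) : ∃ a : Fin n → MvPolynomial (Fin n) (ZMod 2),
      ∑ j, a j * rel A j = p := by
  have : relIdeal A = Ideal.span (Set.range (rel A)) := by
    unfold relIdeal
    congr 1
    ext p
    simp only [Set.mem_ofPred_eq, Set.mem_range]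
    exact exists_congr fun j => ⟨fun h => h.symm, fun h => h.symm⟩
  rw [this] at h
  exact Ideal.mem_span_range_iff_exists_fun.mp h

attribute [local instance] MvPolynomial.gradedAlgebra

theorem hc_mul_lt (a r : MvPolynomial (Fin n) (ZMod 2)) (hr : r.IsHomogeneous 2) :
    homogeneousComponent 1 (a * r) = 0 := by
  have := DirectSum.coe_decompose_mul_of_right_mem_of_not_le
    (homogeneousSubmodule (Fin n) (ZMod 2)) (a := a) (b := r) (i := 2) (n := 1) hr (by norm_num)
  rw [← decomposition.decompose'_apply]
  exact this

theorem hc_mul_eq (a r : MvPolynomial (Fin n) (ZMod 2)) (hr : r.IsHomogeneous 2) :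
    homogeneousComponent 2 (a * r) = C (coeff 0 a) * r := by
  have := DirectSum.coe_decompose_mul_of_right_mem_of_le
    (homogeneousSubmodule (Fin n) (ZMod 2)) (a := a) (b := r) (i := 2) (n := 2) hr le_rfl
  rw [← homogeneousComponent_zero, ← decomposition.decompose'_apply,
    ← decomposition.decompose'_apply]
  exact this

theorem mem_rel_one {A : Matrix (Fin n) (Fin n) (ZMod 2)} {p : MvPolynomial (Fin n) (ZMod 2)}
    (h : p ∈ relIdeal A) (hp : p.IsHomogeneous 1) : p = 0 := by
  obtain ⟨a, rfl⟩ := mem_rel h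
  have := homogeneousComponent_of_mem (n := 1) (m := 1) hp
  rw [if_pos rfl, map_sum] at this
  rw [← this]
  exact Finset.sum_eq_zero fun j _ => hc_mul_lt _ _ (rel_hom A j)

theorem mem_rel_two {A : Matrix (Fin n) (Fin n) (ZMod 2)} {p : MvPolynomial (Fin n) (ZMod 2)}
    (h : p ∈ relIdeal A) (hp : p.IsHomogeneous 2) :
    ∃ c : Fin n → ZMod 2, p = ∑ j, C (c j) * rel A j := by
  obtain ⟨a, rfl⟩ := mem_rel h
  have := homogeneousComponent_of_mem (n := 2) (m := 2) hp
  rw [if_pos rfl, map_sum] at this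
  refine ⟨fun j => coeff 0 (a j), ?_⟩
  rw [← this]
  exact Finset.sum_congr rfl fun j _ => hc_mul_eq _ _ (rel_hom A j)

theorem eval_rel (A : Matrix (Fin n) (Fin n) (ZMod 2)) (j : Fin n) (w : Fin n → ZMod 2) :
    eval w (rel A j) = w j ^ 2 - w j * ∑ i, A i j * w i := by
  simp [rel, eval_lin]

/-- the key consequence of `u v = 0` in `R(A)` -/
theorem zero_prod {A : Matrix (Fin n) (Fin n) (ZMod 2)}
    (hA : ∀ i j : Fin n, j ≤ i → A i j = 0) {u v : Fin n → ZMod 2}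
    (h : lin u * lin v ∈ relIdeal A) (i j : Fin n) (hij : i < j) :
    u i * v j + u j * v i = u j * v j * A i j := by
  obtain ⟨c, hc⟩ := mem_rel_two h ((lin_hom u).mul (lin_hom v))
  have hne : i ≠ j := hij.ne
  have hsing : ∀ k : Fin n, u k * v k = c k := by
    intro k
    have := congrArg (eval (Pi.single k 1)) hc
    simp only [map_mul, map_sum, eval_lin, eval_rel, eval_C] at this
    simp only [Pi.single_apply, mul_ite, mul_one, mul_zero, Finset.sum_ite_eq',
      Finset.mem_univ, if_true, ite_mul, zero_mul, one_mul] at this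
    rw [this, Finset.sum_eq_single k]
    · simp [hA k k le_rfl]
    · intro b _ hb; simp [hb]
    · simp
  have h2 := congrArg (eval (Pi.single i 1 + Pi.single j 1)) hc
  simp only [map_mul, map_sum, eval_lin, eval_rel, eval_C] at h2
  simp only [Pi.add_apply, Pi.single_apply, mul_add, Finset.sum_add_distrib, mul_ite, mul_one,
    mul_zero, Finset.sum_ite_eq', Finset.mem_univ, if_true] at h2
  rw [← Finset.sum_subset (Finset.subset_univ {i, j}), Finset.sum_pair hne] at h2
  · simp [hne, hne.symm, hA i i le_rfl, hA j j le_rfl, hA j i hij.le] at h2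
    rw [← hsing i, ← hsing j] at h2
    revert h2
    generalize u i = a; generalize u j = b; generalize v i = c; generalize v j = d
    generalize A i j = e
    revert a b c d e
    decide
  · intro x _ hx
    simp only [Finset.mem_insert, Finset.mem_singleton, not_or] at hx
    simp [hx.1, hx.2]

/-- eigenspaces -/
theorem eigen_struct {A : Matrix (Fin n) (Fin n) (ZMod 2)}
    (hA : ∀ i j : Fin n, j ≤ i → A i j = 0) {u α : Fin n → ZMod 2}
    (h : lin u * lin (u + α) ∈ relIdeal A) :
    ∃ c : ZMod 2, ∀ j, u j ≠ c * α j → ∀ i, A i j = α i := by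
  have hz := zero_prod hA h
  simp only [Pi.add_apply] at hz
  have h1 : ∀ j, u j = 1 → α j = 0 → ∀ i, A i j = α i := by
    intro j hu hα i
    rcases lt_trichotomy i j with hij | hij | hij
    · have := hz i j hij
      rw [hu, hα] at this
      revert this
      generalize u i = a; generalize A i j = b; generalize α i = c
      revert a b c; decide
    · subst hij; rw [hA i i le_rfl, hα]
    · rw [hA i j hij.le]
      have := hz j i hij
      rw [hu, hα] at this
      revert this
      generalize u i = a; generalize A j i = b; generalize α i = c
      revert a b c; decide
  have h2 : ∀ i j, α i = 1 → α j = 1 → u i = u j := by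
    have aux : ∀ i j, i < j → α i = 1 → α j = 1 → u i = u j := by
      intro i j hij hi hj
      have := hz i j hij
      rw [hi, hj] at this
      revert this
      generalize u i = a; generalize A i j = b; generalize u j = c
      revert a b c; decide
    intro i j hi hj
    rcases lt_trichotomy i j with hij | hij | hij
    · exact aux i j hij hi hj
    · rw [hij]
    · exact (aux j i hij hj hi).symm
  by_cases hex : ∃ i, α i = 1
  · obtain ⟨i, hi⟩ := hex
    refine ⟨u i, fun j hj => ?_⟩
    rcases z2 (α j) with h0 | h0
    · rw [h0, mul_zero] at hj
      exact h1 j (z2_ne hj) h0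
    · exact absurd (by rw [h0, mul_one]; exact h2 j i h0 hi) hj
  · push Not at hex
    refine ⟨0, fun j hj => h1 j (z2_ne (by simpa using hj)) ((z2 _).resolve_right (hex j))⟩

/-- linear map `𝔽₂ⁿ → R(A)` -/
noncomputable def L (A : Matrix (Fin n) (Fin n) (ZMod 2)) :
    (Fin n → ZMod 2) →ₗ[ZMod 2] CohomRing A :=
  Fintype.linearCombination (ZMod 2) (xcl A)

theorem L_eq (A : Matrix (Fin n) (Fin n) (ZMod 2)) (u : Fin n → ZMod 2) :
    L A u = Ideal.Quotient.mk (relIdeal A) (lin u) := by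
  unfold L lin
  rw [Fintype.linearCombination_apply, map_sum]
  refine Finset.sum_congr rfl fun i _ => ?_
  rw [map_mul, Algebra.smul_def]
  rfl

theorem L_mul_zero (A : Matrix (Fin n) (Fin n) (ZMod 2)) (u v : Fin n → ZMod 2) :
    L A u * L A v = 0 ↔ lin u * lin v ∈ relIdeal A := by
  rw [L_eq, L_eq, ← Ideal.Quotient.eq_zero_iff_mem, map_mul]
  rfl

theorem L_inj (A : Matrix (Fin n) (Fin n) (ZMod 2)) : Function.Injective (L A) := by
  intro u v huv
  rw [L_eq, L_eq] at huv
  have h0 := mem_rel_one ((Ideal.Quotient.mk_eq_mk_iff_sub_mem _ _).mp huv)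
    ((lin_hom u).sub (lin_hom v))
  ext i
  have := congrArg (eval (Pi.single i 1)) h0
  rw [map_sub, eval_lin, eval_lin] at this
  simp [Pi.single_apply] at this
  exact sub_eq_zero.mp this

theorem L_range (A : Matrix (Fin n) (Fin n) (ZMod 2)) : LinearMap.range (L A) = H1 A :=
  Fintype.range_linearCombination _ _

theorem L_rel (A : Matrix (Fin n) (Fin n) (ZMod 2)) (j : Fin n) :
    L A (Pi.single j 1) * L A (Pi.single j 1 + fun i => A i j) = 0 := by
  rw [L_mul_zero]
  have e : lin (Pi.single j 1) * lin (Pi.single j 1 + fun i => A i j) = rel A j := by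
    have e1 : lin (Pi.single j (1 : ZMod 2)) = X j := by
      simp [lin, Pi.single_apply]
    have e2 : lin (Pi.single j 1 + fun i => A i j) = lin (Pi.single j 1) + lin (fun i => A i j) := by
      simp [lin, add_mul, Finset.sum_add_distrib]
    rw [e2, e1, rel, CharTwo.sub_eq_add]
    ring
  rw [e]
  exact Ideal.subset_span ⟨j, rfl⟩

/-- eigenspace of `α` -/
noncomputable def E (A : Matrix (Fin n) (Fin n) (ZMod 2)) (α : Fin n → ZMod 2) :
    Submodule (ZMod 2) (Fin n → ZMod 2) where
  carrier := {u | L A u * L A (u + α) = 0}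
  zero_mem' := by simp
  add_mem' := by
    intro u v hu hv
    simp only [Set.mem_ofPred_eq, map_add] at *
    have h2 : L A u * L A v + L A u * L A v = 0 := by
      rw [← two_smul (ZMod 2)]; rw [show (2 : ZMod 2) = 0 from rfl, zero_smul]
    linear_combination hu + hv + h2
  smul_mem' := by
    intro c u hu
    rcases z2 c with rfl | rfl
    · simp
    · simpa using hu

theorem mem_E {A : Matrix (Fin n) (Fin n) (ZMod 2)} {α u : Fin n → ZMod 2} :
    u ∈ E A α ↔ L A u * L A (u + α) = 0 := Iff.rfl

theorem E_eq {A : Matrix (Fin n) (Fin n) (ZMod 2)}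
    (hA : ∀ i j : Fin n, j ≤ i → A i j = 0) (α : Fin n → ZMod 2) :
    E A α = Submodule.span (ZMod 2) {α} ⊔ Submodule.span (ZMod 2)
      (Set.range fun j : {j : Fin n // (fun i => A i j) = α} =>
        (Pi.single j.1 1 : Fin n → ZMod 2)) := by
  apply le_antisymm
  · intro u hu
    obtain ⟨c, hc⟩ := eigen_struct hA ((L_mul_zero _ _ _).1 hu)
    rw [show u = c • α + (u - c • α) by simp]
    refine Submodule.add_mem_sup (Submodule.smul_mem _ _ (Submodule.mem_span_singleton_self α)) ?_
    rw [show u - c • α = ∑ j, (u - c • α) j • (Pi.single j 1 : Fin n → ZMod 2) from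
      pi_eq_sum_univ' _]
    refine Submodule.sum_mem _ fun j _ => ?_
    by_cases h : u j = c * α j
    · simp [h]
    · exact Submodule.smul_mem _ _ (Submodule.subset_span ⟨⟨j, funext (hc j h)⟩, rfl⟩)
  · rw [sup_le_iff, Submodule.span_le, Submodule.span_le]
    constructor
    · intro x hx
      rw [Set.mem_singleton_iff.mp hx]
      rw [SetLike.mem_coe, mem_E]
      have : α + α = 0 := by
        ext i; exact (by decide : ∀ a : ZMod 2, a + a = 0) _
      rw [this]; simp
    · rintro _ ⟨⟨j, rfl⟩, rfl⟩
      exact L_rel A j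

theorem E_finrank {A : Matrix (Fin n) (Fin n) (ZMod 2)}
    (hA : ∀ i j : Fin n, j ≤ i → A i j = 0) (α : Fin n → ZMod 2) :
    Module.finrank (ZMod 2) (E A α) = (if α = 0 then 0 else 1) +
      Fintype.card {j : Fin n // (fun i => A i j) = α} := by
  have hli : LinearIndependent (ZMod 2)
      (fun j : {j : Fin n // (fun i => A i j) = α} => (Pi.single j.1 1 : Fin n → ZMod 2)) := by
    have h := (Pi.basisFun (ZMod 2) (Fin n)).linearIndependent.comp
      (Subtype.val : {j : Fin n // (fun i => A i j) = α} → Fin n) Subtype.val_injective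
    have e : (fun j : {j : Fin n // (fun i => A i j) = α} =>
        (Pi.single j.1 1 : Fin n → ZMod 2)) =
        (Pi.basisFun (ZMod 2) (Fin n)) ∘ Subtype.val := by
      funext j; simp
    rw [e]; exact h
  have hdisj : Disjoint (Submodule.span (ZMod 2) {α}) (Submodule.span (ZMod 2)
      (Set.range fun j : {j : Fin n // (fun i => A i j) = α} =>
        (Pi.single j.1 1 : Fin n → ZMod 2))) := by
    rw [Submodule.disjoint_def]
    intro x hx hx2
    obtain ⟨c, rfl⟩ := Submodule.mem_span_singleton.1 hx
    obtain ⟨f, hf⟩ := (Submodule.mem_span_range_iff_exists_fun _).1 hx2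
    ext m
    by_contra hm
    have h1 : α m ≠ 0 := by
      intro h; apply hm; simp [h]
    have h2 : (fun i => A i m) = α := by
      by_contra hne
      apply hm
      rw [← hf]
      simp only [Finset.sum_apply, Pi.smul_apply, Pi.zero_apply]
      apply Finset.sum_eq_zero
      rintro ⟨j, hj⟩ _
      have : m ≠ j := by rintro rfl; exact hne hj
      simp [this]
    apply h1
    rw [← h2]
    exact hA m m le_rfl
  have h := Submodule.finrank_sup_add_finrank_inf_eq (Submodule.span (ZMod 2) {α})
    (Submodule.span (ZMod 2) (Set.range fun j : {j : Fin n // (fun i => A i j) = α} =>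
        (Pi.single j.1 1 : Fin n → ZMod 2)))
  rw [hdisj.eq_bot, finrank_bot, add_zero, finrank_span_eq_card hli] at h
  rw [E_eq hA, h]
  congr 1
  split_ifs with h0
  · subst h0; simp
  · exact finrank_span_singleton h0

end BottAux

/-- If there is a graded ring isomorphism `R(A) ≃ R(B)` (an `𝔽₂`-algebra
isomorphism mapping the span of the `x_i` onto the span of the `y_i`), then
the strictly upper triangular binary matrices `A` and `B` are Bott
equivalent. -/
theorem bottEquiv_of_cohomIso {n : ℕ}
    (A B : Matrix (Fin n) (Fin n) (ZMod 2))
    (hA : ∀ i j : Fin n, j ≤ i → A i j = 0)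
    (hB : ∀ i j : Fin n, j ≤ i → B i j = 0)
    (h : ∃ φ : CohomRing A ≃ₐ[ZMod 2] CohomRing B,
      Submodule.map φ.toLinearMap (H1 A) = H1 B) :
    BottEquivM A B := by
  obtain ⟨φ, hφ⟩ := h
  -- the induced linear isomorphism
  have hmem : ∀ u, φ (BottAux.L A u) ∈ LinearMap.range (BottAux.L B) := by
    intro u
    rw [BottAux.L_range, ← hφ]
    refine ⟨BottAux.L A u, ?_, rfl⟩
    rw [SetLike.mem_coe, ← BottAux.L_range]
    exact ⟨u, rfl⟩
  let eB := LinearEquiv.ofInjective (BottAux.L B) (BottAux.L_inj B)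
  let p : (Fin n → ZMod 2) →ₗ[ZMod 2] (Fin n → ZMod 2) :=
    eB.symm.toLinearMap ∘ₗ
      LinearMap.codRestrict (LinearMap.range (BottAux.L B)) (φ.toLinearMap ∘ₗ BottAux.L A) hmem
  have hp : ∀ u, BottAux.L B (p u) = φ (BottAux.L A u) := by
    intro u
    have : eB (p u) = ⟨φ (BottAux.L A u), hmem u⟩ := by
      simp only [p, LinearMap.comp_apply]
      exact eB.apply_symm_apply _
    exact congrArg Subtype.val this
  have hpinj : Function.Injective p := by
    intro u v huv
    apply BottAux.L_inj A
    apply φ.injective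
    rw [← hp, ← hp, huv]
  let P : (Fin n → ZMod 2) ≃ₗ[ZMod 2] (Fin n → ZMod 2) := LinearEquiv.ofInjectiveEndo p hpinj
  have hP : ∀ u, BottAux.L B (P u) = φ (BottAux.L A u) := hp
  have hE : ∀ α u, u ∈ BottAux.E A α ↔ P u ∈ BottAux.E B (P α) := by
    intro α u
    rw [BottAux.mem_E, BottAux.mem_E, ← map_add P, hP, hP, ← map_mul φ]
    exact (EmbeddingLike.map_eq_zero_iff (f := φ)).symm
  have hcard : ∀ α, Fintype.card {j : Fin n // (fun i => A i j) = α} =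
      Fintype.card {j : Fin n // (fun i => B i j) = P α} := by
    intro α
    have h1 := BottAux.E_finrank hA α
    have h2 := BottAux.E_finrank hB (P α)
    have h3 : BottAux.E B (P α) = (BottAux.E A α).map P.toLinearMap := by
      ext v
      rw [Submodule.mem_map]
      constructor
      · intro hv
        refine ⟨P.symm v, (hE _ _).2 (by simpa using hv), by simp⟩
      · rintro ⟨u, hu, rfl⟩
        exact (hE _ _).1 hu
    rw [h3, LinearEquiv.finrank_map_eq P, h1] at h2
    simpa using h2
  -- the permutation
  have hex : ∃ σ : Equiv.Perm (Fin n), ∀ j, (fun i => B i (σ j)) = P (fun i => A i j) := by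
    let f : Fin n → (Fin n → ZMod 2) := fun j => P (fun i => A i j)
    let g : Fin n → (Fin n → ZMod 2) := fun j i => B i j
    have hfg : ∀ β, Nonempty ({j // f j = β} ≃ {j // g j = β}) := by
      intro β
      rw [← Fintype.card_eq]
      have := hcard (P.symm β)
      rw [P.apply_symm_apply] at this
      rw [← this]
      apply Fintype.card_congr
      apply Equiv.subtypeEquivRight
      intro j
      simp only [f]
      exact (LinearEquiv.eq_symm_apply P).symm
    have e := fun β => Classical.choice (hfg β)
    refine ⟨(Equiv.sigmaFiberEquiv f).symm.trans ((Equiv.sigmaCongrRight e).trans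
      (Equiv.sigmaFiberEquiv g)), fun j => ?_⟩
    exact (e (f j) ⟨j, rfl⟩).2
  obtain ⟨σ, hσ⟩ := hex
  have hcol : ∀ j, ∃ c : ZMod 2, ∀ i, P (Pi.single j 1) i ≠ c * B i (σ j) →
      ∀ x, B x i = B x (σ j) := by
    intro j
    have h1 : P (Pi.single j 1) ∈ BottAux.E B (fun i => B i (σ j)) := by
      rw [hσ, ← hE]
      exact BottAux.L_rel A j
    exact BottAux.eigen_struct hB ((BottAux.L_mul_zero _ _ _).1 h1)
  choose c hc using hcol
  let M : Matrix (Fin n) (Fin n) (ZMod 2) := LinearMap.toMatrix' P.toLinearMap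
  let M' : Matrix (Fin n) (Fin n) (ZMod 2) :=
    Matrix.of fun i j => P (Pi.single j 1) (σ i)
  have hM : ∀ i j, M i j = P (Pi.single j 1) i := by
    intro i j
    simp [M, LinearMap.toMatrix'_apply]
  have hMA : M' * A = PhiP σ B := by
    ext i j
    rw [BottAux.PhiP_apply]
    have h1 := congrFun (hσ j) (σ i)
    rw [show B (σ i) (σ j) = P (fun i => A i j) (σ i) from h1]
    have h2 : P (fun i => A i j) = M *ᵥ (fun i => A i j) := by
      simp [M, LinearMap.toMatrix'_mulVec]
    rw [h2, Matrix.mul_apply]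
    simp [Matrix.mulVec, dotProduct, hM, M']
  have hinv : ∃ R, M' * R = 1 := by
    have h1 : M * LinearMap.toMatrix' P.symm.toLinearMap = 1 := by
      rw [← LinearMap.toMatrix'_comp]; simp
    refine ⟨Matrix.of fun i j => LinearMap.toMatrix' P.symm.toLinearMap i (σ j), ?_⟩
    ext i j
    have h2 := congrFun (congrFun h1 (σ i)) (σ j)
    rw [Matrix.mul_apply] at h2 ⊢
    simp only [hM] at h2
    simp only [M', Matrix.of_apply, h2, Matrix.one_apply, σ.injective.eq_iff]
  have hmain := BottAux.equiv_main (Finset.univ.filter fun k => c k = 1) A M'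
    (Matrix.of fun i j => M' i j - c j * B (σ i) (σ j)) hA hinv ?_ ?_
  · rw [hMA] at hmain
    have h1 := BottStep.op1 σ⁻¹ (PhiP σ B)
    have h2 : PhiP σ⁻¹ (PhiP σ B) = B := by
      ext i j
      simp [BottAux.PhiP_apply]
    rw [h2] at h1
    exact hmain.tail h1
  · rw [hMA]
    ext i j
    rw [Matrix.add_apply, Matrix.mul_diagonal, BottAux.PhiP_apply]
    rcases BottAux.z2 (c j) with h | h <;> simp [h]
  · intro i j hij x
    have h1 : P (Pi.single j 1) (σ i) ≠ c j * B (σ i) (σ j) := by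
      intro h0; apply hij; simp [M', h0]
    have h2 := funext (hc j (σ i) h1)
    rw [hσ i, hσ j] at h2
    exact congrFun (P.injective h2) x
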